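/- Let T be a dependent (NIP) theory and A a small set over which forking equals dividing (for example, a model). Then every partial type which is Lascar invariant over A (fixed by every Lascar strong automorphism over A) extends to a complete global type which is Lascar invariant over A. -/

import Mathlib

open FirstOrder

universe u

namespace ForkingNTP2

variable (L : FirstOrder.Language.{u, u}) (M : Type u) [L.Structure M]

/-- Two tuples have the same (complete) type over the parameter set `A`,
computed in the monster model `M`. -/
def EqTypeOver (A : Set M) {δ : Type*} (a b : δ → M) : Prop :=
  ∀ (γ : Type u) (φ : L.Formula (δ ⊕ γ)) (c : γ → M), Set.range c ⊆ A →
    (φ.Realize (Sum.elim a c) ↔ φ.Realize (Sum.elim b c))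

/-- The family of formulas `φ(x, bs i)`, `i < ω`, is `k`-inconsistent: every
`k`-element subset is inconsistent. -/
def KInconsistent {α β : Type*} (k : ℕ) (φ : L.Formula (α ⊕ β)) (bs : ℕ → β → M) : Prop :=
  ∀ s : Finset ℕ, s.card = k → ¬ ∃ x : α → M, ∀ i ∈ s, φ.Realize (Sum.elim x (bs i))

/-- `φ(x, b)` `k`-divides over `A`. -/
def KDivides {α β : Type*} (A : Set M) (k : ℕ) (φ : L.Formula (α ⊕ β)) (b : β → M) : Prop :=
  ∃ bs : ℕ → β → M, (∀ i, EqTypeOver L M A (bs i) b) ∧ KInconsistent L M k φ bs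

/-- `φ(x, b)` divides over `A`. -/
def Divides {α β : Type*} (A : Set M) (φ : L.Formula (α ⊕ β)) (b : β → M) : Prop :=
  ∃ k, KDivides L M A k φ b

/-- `φ(x, b)` forks over `A`: it implies a finite disjunction of formulas,
each of which divides over `A`. -/
def Forks {α β : Type*} (A : Set M) (φ : L.Formula (α ⊕ β)) (b : β → M) : Prop :=
  ∃ (n : ℕ) (γ : Fin n → Type u) (ψ : ∀ i, L.Formula (α ⊕ γ i)) (c : ∀ i, γ i → M),
    (∀ i, Divides L M A (ψ i) (c i)) ∧
    ∀ x : α → M, φ.Realize (Sum.elim x b) → ∃ i, (ψ i).Realize (Sum.elim x (c i))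

/-- The complete type `tp(a / P)` forks over `A`: some formula with parameters
in `P` satisfied by `a` forks over `A`. -/
def TpForks {α : Type*} (A : Set M) (a : α → M) (P : Set M) : Prop :=
  ∃ (γ : Type u) (φ : L.Formula (α ⊕ γ)) (b : γ → M),
    Set.range b ⊆ P ∧ φ.Realize (Sum.elim a b) ∧ Forks L M A φ b

/-- `φ(x, e)` quasi divides over `A`: finitely many `A`-conjugates of `e` make
the corresponding instances inconsistent. -/
def QuasiDivides {α ε : Type*} (A : Set M) (φ : L.Formula (α ⊕ ε)) (e : ε → M) : Prop :=
  ∃ (m : ℕ) (es : Fin m → ε → M), (∀ j, EqTypeOver L M A (es j) e) ∧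
    ¬ ∃ x : α → M, ∀ j, φ.Realize (Sum.elim x (es j))

/-- `f` is an `A`-indiscernible sequence (of `β`-tuples). -/
def IndiscSeq {β : Type*} (A : Set M) (f : ℕ → β → M) : Prop :=
  ∀ (n : ℕ) (g h : Fin n → ℕ), StrictMono g → StrictMono h →
    EqTypeOver L M A (fun p : Fin n × β => f (g p.1) p.2)
      (fun p : Fin n × β => f (h p.1) p.2)

/-- The automorphism `σ` fixes the set `A` pointwise. -/
def FixesSet (σ : M ≃[L] M) (A : Set M) : Prop := ∀ a ∈ A, σ a = a

/-- `σ` is a Lascar strong automorphism over `A`: a finite product of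
automorphisms, each fixing pointwise some small model containing `A`. -/
def IsLascarStrong (κ : Cardinal.{u}) (A : Set M) (σ : M ≃[L] M) : Prop :=
  ∃ l : List (M ≃[L] M),
    (∀ τ ∈ l, ∃ N : L.ElementarySubstructure M,
      Cardinal.mk (N : Set M) < κ ∧ A ⊆ (N : Set M) ∧ FixesSet L M τ (N : Set M)) ∧
    σ = l.foldr (fun τ ρ => τ.comp ρ) (Language.Equiv.refl L M)

/-- A complete global type in variables `α`: a complete, finitely satisfiable
(in the monster) collection of formulas `φ(x, b)` with parameters `b` in `M`. -/
structure GType (α : Type u) where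
  mem : L.Formula (α ⊕ ℕ) → (ℕ → M) → Prop
  finsat : ∀ l : List (L.Formula (α ⊕ ℕ) × (ℕ → M)),
    (∀ q ∈ l, mem q.1 q.2) → ∃ x : α → M, ∀ q ∈ l, q.1.Realize (Sum.elim x q.2)
  complete : ∀ φ b, mem φ b ∨ mem φ.not b

/-- `c` realizes the restriction `p|C` of the global type `p`. -/
def GType.RealizesRestr {α : Type u} (p : GType L M α) (C : Set M) (c : α → M) : Prop :=
  ∀ (φ : L.Formula (α ⊕ ℕ)) (b : ℕ → M), p.mem φ b → Set.range b ⊆ C →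
    φ.Realize (Sum.elim c b)

/-- The global type `p` extends `tp(a / C)`. -/
def GType.Extends {α : Type u} (p : GType L M α) (a : α → M) (C : Set M) : Prop :=
  ∀ (φ : L.Formula (α ⊕ ℕ)) (b : ℕ → M), Set.range b ⊆ C →
    φ.Realize (Sum.elim a b) → p.mem φ b

/-- The global type `p` is invariant under the automorphism `σ`. -/
def GType.InvUnder {α : Type u} (p : GType L M α) (σ : M ≃[L] M) : Prop :=
  ∀ φ b, p.mem φ b ↔ p.mem φ (fun i => σ (b i))

/-- The global type `p` is (strongly) Lascar invariant over `A`. -/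
def GType.LascarInv {α : Type u} (κ : Cardinal.{u}) (A : Set M) (p : GType L M α) : Prop :=
  ∀ σ : M ≃[L] M, IsLascarStrong L M κ A σ → GType.InvUnder L M p σ

/-- The global type `p` forks over `A`. -/
def GType.ForksOver {α : Type u} (p : GType L M α) (A : Set M) : Prop :=
  ∃ (φ : L.Formula (α ⊕ ℕ)) (b : ℕ → M), p.mem φ b ∧ Forks L M A φ b

/-- `a ⫝ⁱ_A B`: `tp(a / A ∪ B)` has a global extension which is Lascar
invariant over `A`. -/
def IIndep (κ : Cardinal.{u}) {α : Type u} (A : Set M) (a : α → M) (B : Set M) : Prop :=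
  ∃ p : GType L M α, GType.Extends L M p a (A ∪ B) ∧ GType.LascarInv L M κ A p

/-- `a ⫝ⁱˢᵗ_A B`: `tp(a / A ∪ B)` has a global extension `p` which is Lascar
invariant over `A` and such that for every `C ⊇ A` and every `c ⊨ p|C`,
`tp(C / A ∪ c)` does not fork over `A` (strict invariance). -/
def IstIndep (κ : Cardinal.{u}) {α : Type u} (A : Set M) (a : α → M) (B : Set M) : Prop :=
  ∃ p : GType L M α, GType.Extends L M p a (A ∪ B) ∧ GType.LascarInv L M κ A p ∧
    ∀ C : Set M, A ⊆ C → ∀ c : α → M, GType.RealizesRestr L M p C c →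
      ¬ TpForks L M A (fun x : C => (x : M)) (A ∪ Set.range c)

/-- `T` has the tree property of the second kind. -/
def TP2 : Prop :=
  ∃ (n m k : ℕ) (φ : L.Formula ((Fin n : Type) ⊕ (Fin m : Type))) (a : ℕ → ℕ → Fin m → M),
    (∀ j : ℕ, KInconsistent L M k φ (fun i => a i j)) ∧
    ∀ f : ℕ → ℕ, ∃ x : Fin n → M, ∀ j : ℕ, φ.Realize (Sum.elim x (a (f j) j))

/-- `T` is NTP₂. -/
def NTP2 : Prop := ¬ TP2 L M

/-- `T` is dependent (NIP): no formula has the independence property. -/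
def IsNIP : Prop :=
  ¬ ∃ (n m : ℕ) (φ : L.Formula ((Fin n : Type) ⊕ (Fin m : Type)))
      (a : ℕ → Fin n → M) (b : Set ℕ → Fin m → M),
    ∀ (i : ℕ) (u : Set ℕ), φ.Realize (Sum.elim (a i) (b u)) ↔ i ∈ u

/-- Forking equals dividing over `A`. -/
def ForkEqDiv (A : Set M) : Prop :=
  ∀ (α β : Type u) (φ : L.Formula (α ⊕ β)) (b : β → M), Forks L M A φ b → Divides L M A φ b

/-- `A` is an extension base for non-forking: no type over `A` forks over `A`. -/
def ForkingExtBase (A : Set M) : Prop := ∀ (α : Type u) (a : α → M), ¬ TpForks L M A a A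

/-- Non-forking has left extension over `A`. -/
def ForkingLeftExt (A : Set M) : Prop :=
  ∀ (α δ β : Type u) (a : α → M) (bb : β → M) (d : α ⊕ δ → M), d ∘ Sum.inl = a →
    ¬ TpForks L M A a (A ∪ Set.range bb) →
    ∃ d' : α ⊕ δ → M, EqTypeOver L M (A ∪ Set.range a) d' d ∧
      ¬ TpForks L M A d' (A ∪ Set.range bb)

/-- `M` is a monster model (κ-saturated and strongly κ-homogeneous). -/
structure IsMonster (κ : Cardinal.{u}) : Prop where
  aleph0_lt : Cardinal.aleph0 < κ
  saturated : ∀ (A : Set M), Cardinal.mk A < κ → ∀ (α : Type u), Cardinal.mk α < κ →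
    ∀ S : Set (L.Formula (α ⊕ ℕ) × (ℕ → M)),
      (∀ q ∈ S, Set.range q.2 ⊆ A) →
      (∀ l : List (L.Formula (α ⊕ ℕ) × (ℕ → M)), (∀ q ∈ l, q ∈ S) →
        ∃ x : α → M, ∀ q ∈ l, q.1.Realize (Sum.elim x q.2)) →
      ∃ x : α → M, ∀ q ∈ S, q.1.Realize (Sum.elim x q.2)
  homogeneous : ∀ (A : Set M), Cardinal.mk A < κ → ∀ (α : Type u), Cardinal.mk α < κ →
    ∀ a b : α → M, EqTypeOver L M A a b →
      ∃ σ : M ≃[L] M, FixesSet L M σ A ∧ ∀ i, σ (a i) = b i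

/-- An abstract pre-independence relation `R A C B` (read `A ⫝_C B`) satisfying
properties (1)-(7): invariance, monotonicity, base monotonicity, right
extension, transitivity on the left, being stronger than invariance, and
preservation of indiscernibles. -/
structure PreIndep (κ : Cardinal.{u}) (R : Set M → Set M → Set M → Prop) : Prop where
  invariance : ∀ (σ : M ≃[L] M) (A C B : Set M),
    R A C B → R ((fun x => σ x) '' A) ((fun x => σ x) '' C) ((fun x => σ x) '' B)
  monotone : ∀ A A' C B B' : Set M, A' ⊆ A → B' ⊆ B → R A C B → R A' C B'
  baseMono : ∀ A C B D : Set M, R A C (B ∪ D) → R A (C ∪ B) D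
  rightExt : ∀ A C B D : Set M, R A C B → B ⊆ D →
    ∃ σ : M ≃[L] M, FixesSet L M σ (B ∪ C) ∧ R A C ((fun x => σ x) '' D)
  leftTrans : ∀ A₁ A₂ C B : Set M, R A₁ C B → R A₂ (C ∪ A₁) (B ∪ A₁) → R (A₁ ∪ A₂) C B
  strongerInv : ∀ A C B : Set M, R A C B →
    ∃ p : GType L M A, GType.Extends L M p (fun x : A => (x : M)) (B ∪ C) ∧
      GType.LascarInv L M κ C p
  presIndisc : ∀ (β : Type u) (f : ℕ → β → M) (A C : Set M),
    IndiscSeq L M C f → R A C (⋃ i, Set.range (f i)) → IndiscSeq L M (A ∪ C) f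

/-- `R` has left extension over `A`. -/
def LeftExtOver (R : Set M → Set M → Set M → Prop) (A : Set M) : Prop :=
  ∀ B C D : Set M, R B A C → B ⊆ D →
    ∃ σ : M ≃[L] M, FixesSet L M σ (A ∪ B) ∧ R ((fun x => σ x) '' D) A C

/-- `A` is an extension base for `R`: `a ⫝_A A` for every tuple `a`. -/
def RExtBase (R : Set M → Set M → Set M → Prop) (A : Set M) : Prop :=
  ∀ (α : Type u) (a : α → M), R (Set.range a) A A

/-- `σ` and `a` have the same Lascar strong type over `A`. -/
def EqLstp (κ : Cardinal.{u}) {ε : Type*} (A : Set M) (a b : ε → M) : Prop :=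
  ∃ σ : M ≃[L] M, IsLascarStrong L M κ A σ ∧ ∀ i, σ (a i) = b i

/-- `φ(x, e)` quasi Lascar divides over `A`. -/
def QuasiLascarDivides (κ : Cardinal.{u}) {α ε : Type*} (A : Set M)
    (φ : L.Formula (α ⊕ ε)) (e : ε → M) : Prop :=
  ∃ (m : ℕ) (es : Fin m → ε → M), (∀ j, EqLstp L M κ A e (es j)) ∧
    ¬ ∃ x : α → M, ∀ j, φ.Realize (Sum.elim x (es j))

/-- An alternation chain of length `n` for `φ(x, y)`. -/
def AltChain {α β : Type*} (φ : L.Formula (α ⊕ β)) (n : ℕ) : Prop :=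
  ∃ (as : ℕ → α → M) (b : β → M), IndiscSeq L M (∅ : Set M) as ∧
    ∀ i : ℕ, i < n - 1 →
      (φ.Realize (Sum.elim (as i) b) ↔ ¬ φ.Realize (Sum.elim (as (i + 1)) b))

/-- `k` is the alternation number of `φ`. -/
def AltNumber {α β : Type*} (φ : L.Formula (α ⊕ β)) (k : ℕ) : Prop :=
  AltChain L M φ k ∧ ∀ n : ℕ, AltChain L M φ n → n ≤ k


section Helpers

variable {L M}

theorem elim_comp' {δ γ K K' : Type*} (f : K → K') (a : δ → K) (c : γ → K) :
    f ∘ Sum.elim a c = Sum.elim (fun i => f (a i)) (fun i => f (c i)) := by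
  ext x; cases x <;> rfl

theorem realize_aut {δ : Type*} (σ : M ≃[L] M) (φ : L.Formula δ) (v : δ → M) :
    φ.Realize (fun i => σ (v i)) ↔ φ.Realize v :=
  Language.StrongHomClass.realize_formula σ φ (v := v)

theorem realize_aut_elim {δ γ : Type*} (σ : M ≃[L] M) (φ : L.Formula (δ ⊕ γ))
    (a : δ → M) (c : γ → M) :
    φ.Realize (Sum.elim (fun i => σ (a i)) (fun i => σ (c i))) ↔ φ.Realize (Sum.elim a c) := by
  rw [← elim_comp']; exact realize_aut σ φ _

theorem exists_ultrafilter {X ι : Type*} (S : Set ι) (P : ι → X → Prop)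
    (h : ∀ l : List ι, (∀ q ∈ l, q ∈ S) → ∃ x, ∀ q ∈ l, P q x) :
    ∃ U : Ultrafilter X, ∀ q ∈ S, {x | P q x} ∈ U := by
  classical
  have hne : (Filter.generate ((fun q => {x | P q x}) '' S)).NeBot := by
    rw [Filter.generate_neBot_iff]
    intro t ht hf
    have : ∀ s ∈ t, ∃ q ∈ S, {x | P q x} = s := fun s hs => ht hs
    rcases isEmpty_or_nonempty ι with hι | hι
    · obtain ⟨x, _⟩ := h [] (by simp)
      exact ⟨x, fun s hs => by obtain ⟨q, _⟩ := ht hs; exact hι.elim q⟩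
    choose! g hg1 hg2 using this
    obtain ⟨x, hx⟩ := h (hf.toFinset.toList.map g) (by
      intro q hq
      simp only [List.mem_map, Finset.mem_toList, Set.Finite.mem_toFinset] at hq
      obtain ⟨s, hs, rfl⟩ := hq
      exact hg1 s hs)
    refine ⟨x, fun s hs => ?_⟩
    rw [← hg2 s hs]
    exact hx _ (by simp only [List.mem_map, Finset.mem_toList, Set.Finite.mem_toFinset]
                   exact ⟨s, hs, rfl⟩)
  refine ⟨Ultrafilter.of (Filter.generate ((fun q => {x | P q x}) '' S)), fun q hq => ?_⟩
  exact (Ultrafilter.of_le _) (Filter.GenerateSets.basic ⟨q, hq, rfl⟩)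

/-- Reduce the left block of variables to finitely many. -/
theorem reduce_left {α β : Type*} (φ : L.Formula (α ⊕ β)) :
    ∃ (m : ℕ) (f : Fin m → α) (φ' : L.Formula (Fin m ⊕ β)), Function.Injective f ∧
      ∀ (K : Type u) [L.Structure K] (x : α → K) (b : β → K),
        φ'.Realize (Sum.elim (fun i => x (f i)) b) ↔ φ.Realize (Sum.elim x b) := by
  classical
  let s : Finset α := φ.freeVarFinset.preimage Sum.inl Sum.inl_injective.injOn
  let e := s.equivFin
  let r : φ.freeVarFinset → Fin s.card ⊕ β := fun v =>
    match v with
    | ⟨Sum.inl a, h⟩ => Sum.inl (e ⟨a, by simpa [s] using h⟩)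
    | ⟨Sum.inr b, _⟩ => Sum.inr b
  refine ⟨s.card, fun i => (e.symm i).1, Language.BoundedFormula.restrictFreeVar φ r, ?_, ?_⟩
  · intro i j hij
    exact e.symm.injective (Subtype.ext hij)
  · intro K _ x b
    refine Language.BoundedFormula.realize_restrictFreeVar _ ?_
    rintro ⟨a | b, h⟩ <;> simp [r]

theorem reduce_right {α β : Type*} (φ : L.Formula (α ⊕ β)) :
    ∃ (m : ℕ) (f : Fin m → β) (φ' : L.Formula (α ⊕ Fin m)), Function.Injective f ∧
      ∀ (K : Type u) [L.Structure K] (x : α → K) (b : β → K),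
        φ'.Realize (Sum.elim x (fun i => b (f i))) ↔ φ.Realize (Sum.elim x b) := by
  obtain ⟨m, f, φ', hf, h⟩ := reduce_left (φ.relabel Sum.swap)
  refine ⟨m, f, φ'.relabel Sum.swap, hf, fun K _ x b => ?_⟩
  have := h K b x
  rw [Language.Formula.realize_relabel] at this ⊢
  simpa [Sum.elim_swap] using this

theorem exists_extend {K : Type*} [Nonempty K] {m : ℕ} {α : Type*} (f : Fin m → α)
    (hf : Function.Injective f) (x : Fin m → K) : ∃ y : α → K, ∀ i, y (f i) = x i :=
  ⟨Function.extend f x (fun _ => Classical.arbitrary K), fun _ => hf.extend_apply _ _ _⟩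

theorem exists_ex {α β : Type*} (φ : L.Formula (α ⊕ β)) :
    ∃ ψ : L.Formula β, ∀ (K : Type u) [L.Structure K] [Nonempty K] (b : β → K),
      ψ.Realize b ↔ ∃ x : α → K, φ.Realize (Sum.elim x b) := by
  obtain ⟨m, f, φ', hf, h⟩ := reduce_left φ
  refine ⟨(φ'.relabel Sum.swap).iExs (Fin m), fun K _ _ b => ?_⟩
  rw [Language.Formula.realize_iExs]
  simp only [Language.Formula.realize_relabel, Sum.elim_swap]
  constructor
  · rintro ⟨x, hx⟩
    obtain ⟨y, hy⟩ := exists_extend f hf x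
    refine ⟨y, (h K y b).1 ?_⟩
    simpa [hy] using hx
  · rintro ⟨x, hx⟩
    exact ⟨_, (h K x b).2 hx⟩

theorem reduce_params {δ γ : Type*} (P : Set M) (hP : P.Nonempty)
    (φ : L.Formula (δ ⊕ γ)) (c : γ → M) (hc : Set.range c ⊆ P) :
    ∃ (φ' : L.Formula (δ ⊕ ℕ)) (c' : ℕ → M), Set.range c' ⊆ P ∧
      ∀ x : δ → M, φ'.Realize (Sum.elim x c') ↔ φ.Realize (Sum.elim x c) := by
  obtain ⟨m, f, φ', hf, h⟩ := reduce_right φ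
  obtain ⟨p0, hp0⟩ := hP
  refine ⟨φ'.relabel (Sum.map id Fin.val), fun n => if hn : n < m then c (f ⟨n, hn⟩) else p0,
    ?_, fun x => ?_⟩
  · rintro _ ⟨n, rfl⟩
    dsimp only
    split_ifs
    · exact hc ⟨_, rfl⟩
    · exact hp0
  · rw [Language.Formula.realize_relabel, ← h M x c]
    apply iff_of_eq
    congr 1
    ext (i | i) <;> simp

theorem EqTypeOver.comp {A : Set M} {δ δ' : Type*} {a b : δ → M} (h : EqTypeOver L M A a b)
    (f : δ' → δ) : EqTypeOver L M A (fun i => a (f i)) (fun i => b (f i)) := by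
  intro γ φ c hc
  have := h γ (φ.relabel (Sum.map f id)) c hc
  simp only [Language.Formula.realize_relabel, Sum.elim_comp_map] at this
  exact this

theorem EqTypeOver.symm {A : Set M} {δ : Type*} {a b : δ → M} (h : EqTypeOver L M A a b) :
    EqTypeOver L M A b a := fun γ φ c hc => (h γ φ c hc).symm

theorem EqTypeOver.trans {A : Set M} {δ : Type*} {a b d : δ → M} (h : EqTypeOver L M A a b)
    (h' : EqTypeOver L M A b d) :
    EqTypeOver L M A a d := fun γ φ c hc => (h γ φ c hc).trans (h' γ φ c hc)

theorem EqTypeOver.mono {A B : Set M} {δ : Type*} {a b : δ → M} (h : EqTypeOver L M A a b)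
    (hB : B ⊆ A) : EqTypeOver L M B a b := fun γ φ c hc => h γ φ c (hc.trans hB)

theorem EqTypeOver.of_nat {P : Set M} (hP : P.Nonempty) {δ : Type*} {a b : δ → M}
    (h : ∀ (φ : L.Formula (δ ⊕ ℕ)) (c : ℕ → M), Set.range c ⊆ P →
      φ.Realize (Sum.elim a c) → φ.Realize (Sum.elim b c)) : EqTypeOver L M P a b := by
  intro γ φ c hc
  obtain ⟨φ', c', hc', hφ⟩ := reduce_params P hP φ c hc
  rw [← hφ, ← hφ]
  refine ⟨h φ' c' hc', fun hb => ?_⟩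
  by_contra hn
  have := h φ'.not c' hc' (by rwa [Language.Formula.realize_not])
  rw [Language.Formula.realize_not] at this
  exact this hb

theorem eqTypeOver_aut {A : Set M} {δ : Type*} (σ : M ≃[L] M) (hσ : FixesSet L M σ A)
    (a : δ → M) : EqTypeOver L M A a (fun i => σ (a i)) := by
  intro γ φ c hc
  rw [← realize_aut_elim σ]
  have : (fun i => σ (c i)) = c := funext fun i => hσ _ (hc ⟨i, rfl⟩)
  rw [this]

/-- Pairing of two `ℕ`-tuples. -/
def pr {K : Type*} (c d : ℕ → K) : ℕ → K := fun n => Sum.elim c d (Equiv.natSumNatEquivNat.symm n)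

theorem pr_map {K K' : Type*} (f : K → K') (c d : ℕ → K) :
    (fun i => f (pr c d i)) = pr (fun i => f (c i)) (fun i => f (d i)) := by
  ext n; unfold pr; cases Equiv.natSumNatEquivNat.symm n <;> rfl

theorem pr_range {K : Type*} {P : Set K} {c d : ℕ → K} (hc : Set.range c ⊆ P)
    (hd : Set.range d ⊆ P) : Set.range (pr c d) ⊆ P := by
  rintro _ ⟨n, rfl⟩
  unfold pr; cases Equiv.natSumNatEquivNat.symm n
  · exact hc ⟨_, rfl⟩
  · exact hd ⟨_, rfl⟩

/-- relabel a formula to use the first component of a pair. -/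
def onFst {α : Type*} (φ : L.Formula (α ⊕ ℕ)) : L.Formula (α ⊕ ℕ) :=
  φ.relabel (Sum.map id (fun n => Equiv.natSumNatEquivNat (Sum.inl n)))

def onSnd {α : Type*} (φ : L.Formula (α ⊕ ℕ)) : L.Formula (α ⊕ ℕ) :=
  φ.relabel (Sum.map id (fun n => Equiv.natSumNatEquivNat (Sum.inr n)))

theorem realize_onFst {α : Type*} (φ : L.Formula (α ⊕ ℕ)) (x : α → M) (c d : ℕ → M) :
    (onFst φ).Realize (Sum.elim x (pr c d)) ↔ φ.Realize (Sum.elim x c) := by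
  unfold onFst
  rw [Language.Formula.realize_relabel]
  apply iff_of_eq; congr 1
  ext (i | i) <;> simp [pr]

theorem realize_onSnd {α : Type*} (φ : L.Formula (α ⊕ ℕ)) (x : α → M) (c d : ℕ → M) :
    (onSnd φ).Realize (Sum.elim x (pr c d)) ↔ φ.Realize (Sum.elim x d) := by
  unfold onSnd
  rw [Language.Formula.realize_relabel]
  apply iff_of_eq; congr 1
  ext (i | i) <;> simp [pr]

theorem exists_conj {α : Type*} (P : Set M) (hP : P.Nonempty)
    (l : List (L.Formula (α ⊕ ℕ) × (ℕ → M))) (hl : ∀ q ∈ l, Set.range q.2 ⊆ P) :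
    ∃ (θ : L.Formula (α ⊕ ℕ)) (c : ℕ → M), Set.range c ⊆ P ∧
      ∀ (σ : M ≃[L] M) (x : α → M), θ.Realize (Sum.elim x (fun i => σ (c i))) ↔
        ∀ q ∈ l, q.1.Realize (Sum.elim x (fun i => σ (q.2 i))) := by
  induction l with
  | nil =>
    obtain ⟨p0, hp0⟩ := hP
    exact ⟨⊤, fun _ => p0, by rintro _ ⟨_, rfl⟩; exact hp0, fun σ x => by simp⟩
  | cons q l ih =>
    obtain ⟨θ, c, hc, h⟩ := ih (fun q hq => hl q (List.mem_cons_of_mem _ hq))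
    refine ⟨onFst q.1 ⊓ onSnd θ, pr q.2 c, pr_range (hl q List.mem_cons_self) hc, fun σ x => ?_⟩
    rw [pr_map, Language.Formula.realize_inf, realize_onFst, realize_onSnd, h]
    simp

theorem exists_image (N : L.ElementarySubstructure M) (σ : M ≃[L] M) :
    ∃ N' : L.ElementarySubstructure M, (N' : Set M) = (fun x => σ x) '' (N : Set M) := by
  let e := σ.toEmbedding.substructureEquivMap N.toSubstructure
  refine ⟨⟨N.toSubstructure.map σ.toEmbedding.toHom, ?_⟩, rfl⟩
  intro n φ x
  have hx : x = fun i => e (e.symm (x i)) :=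
    funext fun i => (e.apply_symm_apply (x i)).symm
  have h1 := N.isElementary φ (fun i => e.symm (x i))
  have h2 := Language.StrongHomClass.realize_formula e φ (v := fun i => e.symm (x i))
  have h3 := realize_aut σ φ (fun i => ((e.symm (x i) : N.toSubstructure) : M))
  have h4 : (fun i => σ ((e.symm (x i) : N.toSubstructure) : M)) = (fun i => ((x i : M))) := by
    ext i
    conv_rhs => rw [hx]
    rfl
  rw [h4] at h3
  have h5 : (e ∘ fun i => e.symm (x i)) = x := hx.symm
  rw [h5] at h2
  exact h3.trans (h1.trans h2.symm)

theorem lascar_of_divides {κ : Cardinal.{u}} (hM : IsMonster L M κ) [Nonempty M] {A : Set M}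
    (hA : Cardinal.mk A < κ)
    (N : L.ElementarySubstructure M) (hN : Cardinal.mk (N : Set M) < κ) (hAN : A ⊆ (N : Set M))
    {α β : Type u} (hβ : Cardinal.mk β < κ) (φ : L.Formula (α ⊕ β)) (b : β → M)
    (h : Divides L M A φ b) :
    ∃ (n : ℕ) (τ : Fin n → (M ≃[L] M)),
      (∀ j, ∃ N' : L.ElementarySubstructure M,
        Cardinal.mk (N' : Set M) < κ ∧ A ⊆ (N' : Set M) ∧ FixesSet L M (τ j) (N' : Set M)) ∧
      ¬ ∃ x : α → M, ∀ j, φ.Realize (Sum.elim x (fun i => τ j (b i))) := by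
  classical
  obtain ⟨k, bs, hbs, hk⟩ := h
  have hNne : (N : Set M).Nonempty := by
    have : Nonempty N := inferInstance
    obtain ⟨x⟩ := this
    exact ⟨x.1, x.2⟩
  cases k with
  | zero =>
    exact absurd ⟨fun _ => Classical.arbitrary M, by simp⟩ (hk ∅ rfl)
  | succ k =>
  let S : Set (L.Formula ((Fin (k+1) × β) ⊕ ℕ) × (ℕ → M)) := {q | Set.range q.2 ⊆ (N : Set M) ∧
    ∃ X ∈ Filter.hyperfilter ℕ, ∀ g : Fin (k+1) → ℕ, Function.Injective g → (∀ i, g i ∈ X) →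
      q.1.Realize (Sum.elim (fun p => bs (g p.1) p.2) q.2)}
  have hcard : Cardinal.mk (Fin (k+1) × β) < κ := by
    rw [Cardinal.mk_prod]
    refine Cardinal.mul_lt_of_lt hM.aleph0_lt.le ?_ (by simpa using hβ)
    simpa using (Cardinal.natCast_lt_aleph0 (n := k+1)).trans hM.aleph0_lt
  obtain ⟨f, hf⟩ := hM.saturated N hN (Fin (k+1) × β) hcard S (fun q hq => hq.1) (by
    intro l hl
    have : ∃ X ∈ Filter.hyperfilter ℕ, ∀ g : Fin (k+1) → ℕ, Function.Injective g →
        (∀ i, g i ∈ X) → ∀ q ∈ l, q.1.Realize (Sum.elim (fun p => bs (g p.1) p.2) q.2) := by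
      induction l with
      | nil => exact ⟨Set.univ, Filter.univ_mem, by simp⟩
      | cons q l ih =>
        obtain ⟨X, hX, h1⟩ := ih (fun q hq => hl q (List.mem_cons_of_mem _ hq))
        obtain ⟨-, Y, hY, h2⟩ := hl q List.mem_cons_self
        refine ⟨X ∩ Y, Filter.inter_mem hX hY, fun g hg hgX q' hq' => ?_⟩
        rcases List.mem_cons.1 hq' with rfl | hq'
        · exact h2 g hg (fun i => (hgX i).2)
        · exact h1 g hg (fun i => (hgX i).1) q' hq'
    obtain ⟨X, hX, h1⟩ := this
    have hinf : X.Infinite := fun hfin => Filter.notMem_hyperfilter_of_finite hfin hX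
    exact ⟨_, h1 (fun i => hinf.natEmbedding X i)
      (fun i j hij => Fin.ext ((hinf.natEmbedding X).injective (Subtype.ext hij)))
      (fun i => Subtype.coe_prop _)⟩)
  -- the consequences
  have h1 : ∀ j, EqTypeOver L M (N : Set M) (fun i => f (0, i)) (fun i => f (j, i)) := by
    intro j
    refine EqTypeOver.of_nat hNne fun ψ c hc h0 => ?_
    have := hf ((ψ.relabel (Sum.map (fun i => ((0 : Fin (k+1)), i)) id)).imp
      (ψ.relabel (Sum.map (fun i => (j, i)) id)), c) ⟨hc, by
        rcases Ultrafilter.mem_or_compl_mem (Filter.hyperfilter ℕ)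
          {n | ψ.Realize (Sum.elim (bs n) c)} with hX | hX
        · refine ⟨_, hX, fun g _ hg => ?_⟩
          rw [Language.Formula.realize_imp]
          intro _
          rw [Language.Formula.realize_relabel, Sum.elim_comp_map]
          exact hg j
        · refine ⟨_, hX, fun g _ hg => ?_⟩
          rw [Language.Formula.realize_imp]
          intro h0
          rw [Language.Formula.realize_relabel, Sum.elim_comp_map] at h0
          exact absurd h0 (hg 0)⟩
    rw [Language.Formula.realize_imp, Language.Formula.realize_relabel,
      Language.Formula.realize_relabel, Sum.elim_comp_map, Sum.elim_comp_map] at this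
    exact this h0
  have h2 : EqTypeOver L M A (fun i => f (0, i)) b := by
    intro γ ψ c hc
    obtain ⟨ψ', c', hc', hψ⟩ := reduce_params (N : Set M) hNne
      (if ψ.Realize (Sum.elim b c) then ψ else ψ.not) c (hc.trans hAN)
    have := hf (ψ'.relabel (Sum.map (fun i => ((0 : Fin (k+1)), i)) id), c') ⟨hc', Set.univ,
      Filter.univ_mem, fun g _ _ => by
        rw [Language.Formula.realize_relabel, Sum.elim_comp_map]
        refine (hψ _).2 ?_
        have := hbs (g 0) γ ψ c hc
        split_ifs with hh
        · exact this.2 hh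
        · rw [Language.Formula.realize_not]
          exact fun hr => hh (this.1 hr)⟩
    rw [Language.Formula.realize_relabel, Sum.elim_comp_map] at this
    have := (hψ _).1 this
    split_ifs at this with hh
    · exact iff_of_true this hh
    · rw [Language.Formula.realize_not] at this
      exact iff_of_false this hh
  have h3 : ¬ ∃ x : α → M, ∀ j, φ.Realize (Sum.elim x (fun i => f (j, i))) := by
    let φ' : L.Formula (α ⊕ (Fin (k+1) × β)) :=
      Language.Formula.iInf (fun j : Fin (k+1) => φ.relabel (Sum.map id (fun i => (j, i))))
    have hφ' : ∀ (x : α → M) (w : Fin (k+1) × β → M), φ'.Realize (Sum.elim x w) ↔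
        ∀ j, φ.Realize (Sum.elim x (fun i => w (j, i))) := by
      intro x w
      simp only [φ', Language.Formula.realize_iInf, Language.Formula.realize_relabel,
        Sum.elim_comp_map]
      rfl
    obtain ⟨E, hE⟩ := exists_ex φ'
    obtain ⟨n0, hn0⟩ := hNne
    have := hf ((E.not).relabel Sum.inl, fun _ => n0) ⟨by rintro _ ⟨_, rfl⟩; exact hn0, Set.univ,
      Filter.univ_mem, fun g hg _ => by
        rw [Language.Formula.realize_relabel, Sum.elim_comp_inl, Language.Formula.realize_not, hE]
        rintro ⟨x, hx⟩
        rw [hφ'] at hx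
        refine hk (Finset.univ.image g) ?_ ⟨x, ?_⟩
        · rw [Finset.card_image_of_injective _ hg]; simp
        · intro i hi
          simp only [Finset.mem_image, Finset.mem_univ, true_and] at hi
          obtain ⟨j, rfl⟩ := hi
          exact hx j⟩
    rw [Language.Formula.realize_relabel, Sum.elim_comp_inl, Language.Formula.realize_not, hE] at this
    rintro ⟨x, hx⟩
    exact this ⟨x, (hφ' _ _).2 hx⟩
  obtain ⟨σ, hσA, hσ⟩ := hM.homogeneous A hA β hβ _ _ h2
  choose τ hτN hτ using fun j => hM.homogeneous N hN β hβ _ _ (h1 j)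
  obtain ⟨N', hN'⟩ := exists_image N σ
  refine ⟨k+1, fun j => σ.comp ((τ j).comp σ.symm), fun j => ⟨N', ?_, ?_, ?_⟩, ?_⟩
  · rw [hN']; exact Cardinal.mk_image_le.trans_lt hN
  · rw [hN']; exact fun a ha => ⟨a, hAN ha, hσA a ha⟩
  · rw [hN']
    rintro _ ⟨a, ha, rfl⟩
    simp [hτN j a ha]
  · rintro ⟨x, hx⟩
    refine h3 ⟨fun i => σ.symm (x i), fun j => ?_⟩
    rw [← realize_aut_elim σ]
    have e1 : (fun i => σ (σ.symm (x i))) = x := by ext i; simp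
    have e2 : (fun i => σ (f (j, i))) = fun i => (σ.comp ((τ j).comp σ.symm)) (b i) := by
      ext i
      simp [← hσ, hτ]
    rw [e1, e2]
    exact hx j

theorem exists_coheir [Nonempty M] (N : L.ElementarySubstructure M) (b : ℕ → M) :
    ∃ U : Ultrafilter (ℕ → N), ∀ (ψ : L.Formula (ℕ ⊕ ℕ)) (c : ℕ → M),
      Set.range c ⊆ (N : Set M) → ψ.Realize (Sum.elim b c) →
      {d : ℕ → N | ψ.Realize (Sum.elim (fun i => (d i : M)) c)} ∈ U := by
  have hNne : (N : Set M).Nonempty := by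
    have : Nonempty N := inferInstance
    obtain ⟨x⟩ := this
    exact ⟨x.1, x.2⟩
  obtain ⟨U, hU⟩ := exists_ultrafilter (X := ℕ → N)
    {q : L.Formula (ℕ ⊕ ℕ) × (ℕ → M) | Set.range q.2 ⊆ (N : Set M) ∧ q.1.Realize (Sum.elim b q.2)}
    (fun q d => q.1.Realize (Sum.elim (fun i => (d i : M)) q.2)) (by
      intro l hl
      obtain ⟨θ, c, hc, h⟩ := exists_conj (N : Set M) hNne l (fun q hq => (hl q hq).1)
      replace h := h (Language.Equiv.refl L M)
      simp only [Language.Equiv.refl_apply] at h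
      obtain ⟨E, hE⟩ := exists_ex θ
      have h1 : E.Realize c := (hE M c).2 ⟨b, (h b).2 fun q hq => (hl q hq).2⟩
      let c' : ℕ → N := fun i => ⟨c i, hc ⟨i, rfl⟩⟩
      have h2 : E.Realize c' := (N.subtype.map_formula E c').1 h1
      obtain ⟨d, hd⟩ := (hE N c').1 h2
      have h3 := (N.subtype.map_formula θ (Sum.elim d c')).2 hd
      rw [elim_comp'] at h3
      exact ⟨d, (h _).1 h3⟩)
  exact ⟨U, fun ψ c hc h => hU (ψ, c) ⟨hc, h⟩⟩

/-- `d` realizes the restriction to `P` of the type defined by `U`. -/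
def RealU (L : FirstOrder.Language.{u, u}) {M : Type u} [L.Structure M] {N : Set M}
    (U : Ultrafilter (ℕ → N)) (P : Set M) (d : ℕ → M) : Prop :=
  ∀ (ψ : L.Formula (ℕ ⊕ ℕ)) (c : ℕ → M), Set.range c ⊆ P →
    {e : ℕ → N | ψ.Realize (Sum.elim (fun i => (e i : M)) c)} ∈ U → ψ.Realize (Sum.elim d c)

theorem exists_realU {κ : Cardinal.{u}} (hM : IsMonster L M κ) {N : Set M}
    (U : Ultrafilter (ℕ → N)) (P : Set M) (hP : Cardinal.mk P < κ) : ∃ d, RealU L U P d := by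
  obtain ⟨x, hx⟩ := hM.saturated P hP (ULift.{u} ℕ) (by simpa using hM.aleph0_lt)
    {q | Set.range q.2 ⊆ P ∧ {e : ℕ → N | q.1.Realize
      (Sum.elim (fun i => (e i.down : M)) q.2)} ∈ U} (fun q hq => hq.1) (by
      intro l hl
      have : {e : ℕ → N | ∀ q ∈ l, q.1.Realize (Sum.elim (fun i => (e i.down : M)) q.2)} ∈ U := by
        induction l with
        | nil => simp only [List.not_mem_nil, false_imp_iff, implies_true]; exact Filter.univ_mem
        | cons q l ih =>
          have h1 := ih (fun q hq => hl q (List.mem_cons_of_mem _ hq))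
          have h2 := (hl q List.mem_cons_self).2
          refine Filter.mem_of_superset (Filter.inter_mem h1 h2) ?_
          rintro e ⟨h3, h4⟩ q' hq'
          rcases List.mem_cons.1 hq' with rfl | hq'
          · exact h4
          · exact h3 q' hq'
      obtain ⟨e, he⟩ := U.nonempty_of_mem this
      exact ⟨_, he⟩)
  refine ⟨fun i => x ⟨i⟩, fun ψ c hc h => ?_⟩
  have := hx (ψ.relabel (Sum.map ULift.up id), c) ⟨hc, by
    simp only [Language.Formula.realize_relabel, Sum.elim_comp_map]
    exact h⟩
  rw [Language.Formula.realize_relabel, Sum.elim_comp_map] at this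
  exact this

theorem RealU.iff {N : Set M} {U : Ultrafilter (ℕ → N)} {P : Set M} (hP : P.Nonempty) {d : ℕ → M}
    (h : RealU L U P d) {γ : Type*} (ψ : L.Formula (ℕ ⊕ γ)) (c : γ → M) (hc : Set.range c ⊆ P) :
    ψ.Realize (Sum.elim d c) ↔ {e : ℕ → N | ψ.Realize (Sum.elim (fun i => (e i : M)) c)} ∈ U := by
  obtain ⟨ψ', c', hc', hψ⟩ := reduce_params P hP ψ c hc
  simp only [← hψ]
  refine ⟨fun hd => ?_, h ψ' c' hc'⟩
  rcases Ultrafilter.mem_or_compl_mem U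
    {e : ℕ → N | ψ'.Realize (Sum.elim (fun i => (e i : M)) c')} with hX | hX
  · exact hX
  · have := h ψ'.not c' hc' (by
      simp only [Language.Formula.realize_not]
      exact hX)
    rw [Language.Formula.realize_not] at this
    exact absurd hd this

theorem RealU.ext {N : Set M} (hN : N.Nonempty) {U : Ultrafilter (ℕ → N)} {P P' : Set M}
    (hNP : N ⊆ P) (hNP' : N ⊆ P') {d d' : ℕ → M}
    (h : RealU L U P d) (h' : RealU L U P' d') {δ : Type*} {a a' : δ → M}
    (ha : EqTypeOver L M N a a') (haP : Set.range a ⊆ P) (haP' : Set.range a' ⊆ P') :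
    EqTypeOver L M N (Sum.elim a d) (Sum.elim a' d') := by
  intro γ ψ c hc
  let r : (δ ⊕ ℕ) ⊕ γ → ℕ ⊕ (δ ⊕ γ) :=
    Sum.elim (Sum.elim (fun i => Sum.inr (Sum.inl i)) Sum.inl) (fun i => Sum.inr (Sum.inr i))
  have hr : ∀ (a d c), (ψ.relabel r).Realize (Sum.elim d (Sum.elim a c)) ↔
      ψ.Realize (M := M) (Sum.elim (Sum.elim a d) c) := by
    intro a d c
    rw [Language.Formula.realize_relabel]
    apply iff_of_eq; congr 1
    ext ((i | i) | i) <;> rfl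
  let r2 : (δ ⊕ ℕ) ⊕ γ → δ ⊕ (ℕ ⊕ γ) :=
    Sum.elim (Sum.elim (fun i => Sum.inl i) (fun i => Sum.inr (Sum.inl i)))
      (fun i => Sum.inr (Sum.inr i))
  have hr2 : ∀ (a d c), (ψ.relabel r2).Realize (Sum.elim a (Sum.elim d c)) ↔
      ψ.Realize (M := M) (Sum.elim (Sum.elim a d) c) := by
    intro a d c
    rw [Language.Formula.realize_relabel]
    apply iff_of_eq; congr 1
    ext ((i | i) | i) <;> rfl
  rw [← hr, ← hr, h.iff (hN.mono hNP) _ _ (by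
      rw [Set.Sum.elim_range]; exact Set.union_subset haP (hc.trans hNP)),
    h'.iff (hN.mono hNP') _ _ (by
      rw [Set.Sum.elim_range]; exact Set.union_subset haP' (hc.trans hNP'))]
  simp only [hr]
  have : ∀ e : ℕ → N, ψ.Realize (Sum.elim (Sum.elim a (fun i => (e i : M))) c) ↔
      ψ.Realize (Sum.elim (Sum.elim a' (fun i => (e i : M))) c) := by
    intro e
    rw [← hr2, ← hr2]
    refine ha (ℕ ⊕ γ) _ _ ?_
    rw [Set.Sum.elim_range]
    refine Set.union_subset ?_ hc
    rintro _ ⟨i, rfl⟩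
    exact (e i).2
  simp only [this]

theorem exists_seq {κ : Cardinal.{u}} (hM : IsMonster L M κ) [Nonempty M] {N : Set M}
    (hN : Cardinal.mk N < κ) (U : Ultrafilter (ℕ → N)) :
    ∃ bs : ℕ → ℕ → M, ∀ n, ∃ P : Set M, N ⊆ P ∧ (∀ i < n, Set.range (bs i) ⊆ P) ∧
      RealU L U P (bs n) := by
  choose! F hF using fun (P : Set M) (hP : Cardinal.mk P < κ) => exists_realU hM U P hP
  obtain ⟨Ps, hz, hs⟩ : ∃ Ps : ℕ → Set M, Ps 0 = N ∧
      ∀ n, Ps (n+1) = Ps n ∪ Set.range (F (Ps n)) :=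
    ⟨fun n => Nat.rec N (fun _ P => P ∪ Set.range (F P)) n, rfl, fun _ => rfl⟩
  have hsmall : ∀ n, Cardinal.mk (Ps n) < κ := by
    intro n
    induction n with
    | zero => rw [hz]; exact hN
    | succ n ih =>
      rw [hs]
      refine (Cardinal.mk_union_le _ _).trans_lt (Cardinal.add_lt_of_lt hM.aleph0_lt.le ih ?_)
      exact ((Set.countable_range _).le_aleph0).trans_lt hM.aleph0_lt
  have hmono : Monotone Ps := monotone_nat_of_le_succ fun n => by
    rw [hs]; exact Set.subset_union_left
  refine ⟨fun n => F (Ps n), fun n => ⟨Ps n, hz ▸ hmono (Nat.zero_le n), fun i hi => ?_,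
    hF _ (hsmall n)⟩⟩
  refine Set.Subset.trans ?_ (hmono (Nat.succ_le_of_lt hi))
  rw [Nat.succ_eq_add_one, hs]
  exact Set.subset_union_right

theorem indisc_of_seq {N : Set M} (hN : N.Nonempty) (U : Ultrafilter (ℕ → N)) (bs : ℕ → ℕ → M)
    (hbs : ∀ n, ∃ P : Set M, N ⊆ P ∧ (∀ i < n, Set.range (bs i) ⊆ P) ∧ RealU L U P (bs n)) :
    IndiscSeq L M N bs := by
  intro n
  induction n with
  | zero =>
    intro g h _ _
    have : (fun p : Fin 0 × ℕ => bs (g p.1) p.2) = (fun p : Fin 0 × ℕ => bs (h p.1) p.2) := by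
      ext p; exact p.1.elim0
    rw [this]
    exact fun _ _ _ _ => Iff.rfl
  | succ n ih =>
    intro g h hg hh
    have h0 := ih (g ∘ Fin.castSucc) (h ∘ Fin.castSucc) (hg.comp Fin.strictMono_castSucc)
      (hh.comp Fin.strictMono_castSucc)
    obtain ⟨P, hNP, hP, hr⟩ := hbs (g (Fin.last n))
    obtain ⟨P', hNP', hP', hr'⟩ := hbs (h (Fin.last n))
    have h1 := hr.ext hN hNP hNP' hr' h0
      (by rintro _ ⟨p, rfl⟩; exact hP _ (hg (Fin.castSucc_lt_last p.1)) ⟨_, rfl⟩)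
      (by rintro _ ⟨p, rfl⟩; exact hP' _ (hh (Fin.castSucc_lt_last p.1)) ⟨_, rfl⟩)
    let r : Fin (n+1) × ℕ → (Fin n × ℕ) ⊕ ℕ := fun p =>
      if hp : p.1.val < n then Sum.inl (⟨p.1.val, hp⟩, p.2) else Sum.inr p.2
    have hr : ∀ g : Fin (n+1) → ℕ, (fun p => Sum.elim (fun p : Fin n × ℕ =>
        bs ((g ∘ Fin.castSucc) p.1) p.2) (bs (g (Fin.last n))) (r p)) =
        fun p => bs (g p.1) p.2 := by
      intro g
      ext ⟨i, j⟩
      by_cases hi : i.val < n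
      · simp only [r, hi, dif_pos]; rfl
      · have : i = Fin.last n := Fin.ext (by have := i.2; simp; omega)
        subst this
        simp [r]
    have h2 := h1.comp r
    rw [hr g, hr h] at h2
    exact h2

theorem exists_k {κ : Cardinal.{u}} (hM : IsMonster L M κ) [Nonempty M] (hnip : IsNIP L M)
    {N : Set M} {bs : ℕ → ℕ → M} (hbs : IndiscSeq L M N bs) {α : Type u}
    (φ : L.Formula (α ⊕ ℕ)) :
    ∃ k, ∀ s : Finset ℕ, s.card = k → ¬ ∃ x : α → M, ∀ i ∈ s,
      ¬ (φ.Realize (Sum.elim x (bs (2 * i))) ↔ φ.Realize (Sum.elim x (bs (2 * i + 1)))) := by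
  classical
  by_contra hcon
  push Not at hcon
  -- every pattern is finitely realized
  have hpat : ∀ (u : Set ℕ) (K : ℕ), ∃ x : α → M, ∀ i < K,
      (φ.Realize (Sum.elim x (bs i)) ↔ i ∈ u) := by
    intro u K
    obtain ⟨s, hs, x, hx⟩ := hcon K
    let e := s.orderEmbOfFin hs
    have hh : ∀ i : Fin K, ∃ j, (j = 2 * e i ∨ j = 2 * e i + 1) ∧
        (φ.Realize (Sum.elim x (bs j)) ↔ (i : ℕ) ∈ u) := by
      intro i
      have := hx (e i) (s.orderEmbOfFin_mem hs i)
      by_cases h1 : (φ.Realize (Sum.elim x (bs (2 * e i))) ↔ (i : ℕ) ∈ u)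
      · exact ⟨_, Or.inl rfl, h1⟩
      · exact ⟨_, Or.inr rfl, by tauto⟩
    choose h hh1 hh2 using hh
    have hmono : StrictMono h := by
      intro i j hij
      have : e i < e j := e.strictMono hij
      rcases hh1 i with h1 | h1 <;> rcases hh1 j with h2 | h2 <;> omega
    have heq := (hbs K h (fun i => i) hmono (fun i j hij => hij)).mono (Set.empty_subset N)
    obtain ⟨σ, -, hσ⟩ := hM.homogeneous ∅ (by simpa using Cardinal.aleph0_pos.trans hM.aleph0_lt)
      (ULift.{u} (Fin K × ℕ)) (by
        have : Cardinal.mk (ULift.{u} (Fin K × ℕ)) ≤ Cardinal.aleph0 := Cardinal.mk_le_aleph0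
        exact this.trans_lt hM.aleph0_lt) _ _ (heq.comp ULift.down)
    refine ⟨fun i => σ (x i), fun i hi => ?_⟩
    rw [← hh2 ⟨i, hi⟩, ← realize_aut_elim σ φ x]
    have : (fun j => σ (bs (h ⟨i, hi⟩) j)) = bs i := funext fun j => hσ ⟨(⟨i, hi⟩, j)⟩
    rw [this]
  obtain ⟨m, f, φ₁, hf, h₁⟩ := reduce_left φ
  obtain ⟨n, g, φ₂, hg, h₂⟩ := reduce_right φ₁
  have hall : ∀ u : Set ℕ, ∃ y : Fin m → M, ∀ i, φ₁.Realize (Sum.elim y (bs i)) ↔ i ∈ u := by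
    intro u
    let Φ : ℕ → L.Formula (ULift.{u} (Fin m) ⊕ ℕ) := fun i =>
      (if i ∈ u then φ₁ else φ₁.not).relabel (Sum.map ULift.up id)
    have hΦ : ∀ i (y : Fin m → M), (Φ i).Realize (Sum.elim (fun j => y j.down) (bs i)) ↔
        (φ₁.Realize (Sum.elim y (bs i)) ↔ i ∈ u) := by
      intro i y
      simp only [Φ]
      rw [Language.Formula.realize_relabel, Sum.elim_comp_map]
      split_ifs with hi
      · simp only [hi, iff_true]; rfl
      · rw [Language.Formula.realize_not]
        simp only [hi, iff_false]; rfl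
    obtain ⟨x, hx⟩ := hM.saturated (Set.range fun p : ℕ × ℕ => bs p.1 p.2)
      (((Set.countable_range _).le_aleph0).trans_lt hM.aleph0_lt) (ULift.{u} (Fin m))
      (Cardinal.mk_le_aleph0.trans_lt hM.aleph0_lt)
      (Set.range fun i => (Φ i, bs i)) (by
        rintro _ ⟨i, rfl⟩ _ ⟨j, rfl⟩
        exact ⟨(i, j), rfl⟩) (by
        intro l hl
        have : ∃ K, ∀ q ∈ l, ∃ i < K, q = (Φ i, bs i) := by
          clear hΦ
          induction l with
          | nil => exact ⟨0, by simp⟩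
          | cons q l ih =>
            obtain ⟨K, hK⟩ := ih (fun q hq => hl q (List.mem_cons_of_mem _ hq))
            obtain ⟨i, hi⟩ := hl q List.mem_cons_self
            refine ⟨max K (i+1), fun q' hq' => ?_⟩
            rcases List.mem_cons.1 hq' with rfl | hq'
            · exact ⟨i, by omega, hi.symm⟩
            · obtain ⟨j, hj, h⟩ := hK q' hq'
              exact ⟨j, by omega, h⟩
        obtain ⟨K, hK⟩ := this
        obtain ⟨x, hx⟩ := hpat u K
        refine ⟨fun j => x (f j.down), fun q hq => ?_⟩
        obtain ⟨i, hi, rfl⟩ := hK q hq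
        refine (hΦ i (fun j => x (f j))).2 ?_
        rw [h₁]
        exact hx i hi)
    refine ⟨fun j => x ⟨j⟩, fun i => (hΦ i _).1 (hx _ ⟨i, rfl⟩)⟩
  choose y hy using hall
  refine hnip ⟨n, m, φ₂.relabel Sum.swap, fun i j => bs i (g j), y, fun i u => ?_⟩
  rw [← hy u i, Language.Formula.realize_relabel, Sum.elim_swap, h₂]

theorem inv_of_nonforking {κ : Cardinal.{u}} (hM : IsMonster L M κ) [Nonempty M]
    (hnip : IsNIP L M) {A : Set M} {α : Type u} (p : GType L M α)
    (hp : ∀ (ψ : L.Formula (α ⊕ ℕ)) (c : ℕ → M), Divides L M A ψ c → p.mem ψ.not c)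
    (N : L.ElementarySubstructure M) (hN : Cardinal.mk (N : Set M) < κ) (hAN : A ⊆ (N : Set M))
    (τ : M ≃[L] M) (hτ : FixesSet L M τ (N : Set M)) (φ : L.Formula (α ⊕ ℕ)) (b : ℕ → M)
    (hb : p.mem φ b) : p.mem φ (fun i => τ (b i)) := by
  rcases p.complete φ (fun i => τ (b i)) with h | hnb
  · exact h
  exfalso
  have hNne : (N : Set M).Nonempty := by
    have : Nonempty N := inferInstance
    obtain ⟨x⟩ := this
    exact ⟨x.1, x.2⟩
  obtain ⟨U, hU⟩ := exists_coheir N b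
  obtain ⟨bs, hbs⟩ := exists_seq (L := L) hM (N := (N : Set M)) hN U
  obtain ⟨k, hk⟩ := exists_k hM hnip (indisc_of_seq hNne U bs hbs) φ
  have hbsb : ∀ n, EqTypeOver L M (N : Set M) b (bs n) := by
    intro n
    obtain ⟨P, hNP, -, hr⟩ := hbs n
    exact EqTypeOver.of_nat hNne fun ψ c hc h => hr ψ c (hc.trans hNP) (hU ψ c hc h)
  have hsmall : ∀ a : ℕ → M, Cardinal.mk (Set.range a) < κ := fun a =>
    ((Set.countable_range _).le_aleph0).trans_lt hM.aleph0_lt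
  obtain ⟨d, hd⟩ := exists_realU (L := L) hM U
    (((N : Set M) ∪ Set.range b) ∪ Set.range fun i => τ (b i)) (by
      refine (Cardinal.mk_union_le _ _).trans_lt
        (Cardinal.add_lt_of_lt hM.aleph0_lt.le ?_ (hsmall _))
      exact (Cardinal.mk_union_le _ _).trans_lt
        (Cardinal.add_lt_of_lt hM.aleph0_lt.le hN (hsmall _)))
  let χ : L.Formula (α ⊕ ℕ) := ((onFst φ).iff (onSnd φ)).not
  have hχ : ∀ (x : α → M) (c d : ℕ → M), χ.Realize (Sum.elim x (pr c d)) ↔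
      ¬ (φ.Realize (Sum.elim x c) ↔ φ.Realize (Sum.elim x d)) := by
    intro x c d
    simp only [χ]
    rw [Language.Formula.realize_not, Language.Formula.realize_iff, realize_onFst, realize_onSnd]
  have hdiv : ∀ a : ℕ → M, EqTypeOver L M (N : Set M) b a →
      Set.range a ⊆ (((N : Set M) ∪ Set.range b) ∪ Set.range fun i => τ (b i)) →
      Divides L M A χ (pr a d) := by
    intro a hba ha
    refine ⟨k, fun i => pr (bs (2 * i)) (bs (2 * i + 1)), fun i => ?_, ?_⟩
    · obtain ⟨P, hNP, hP, hr⟩ := hbs (2 * i + 1)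
      have := hr.ext hNne hNP
        (Set.subset_union_left.trans Set.subset_union_left) hd ((hbsb (2 * i)).symm.trans hba)
        (hP _ (by omega)) ha
      exact (this.comp Equiv.natSumNatEquivNat.symm).mono hAN
    · rintro s hs ⟨x, hx⟩
      exact hk s hs ⟨x, fun i hi => (hχ _ _ _).1 (hx i hi)⟩
  have m1 := hp _ _ (hdiv b (fun _ _ _ _ => Iff.rfl)
    (Set.subset_union_right.trans Set.subset_union_left))
  have m2 := hp _ _ (hdiv (fun i => τ (b i)) (eqTypeOver_aut τ hτ b) Set.subset_union_right)
  obtain ⟨x, hx⟩ := p.finsat [(φ, b), (φ.not, fun i => τ (b i)), (χ.not, pr b d),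
    (χ.not, pr (fun i => τ (b i)) d)] (by
      intro q hq
      simp only [List.mem_cons, List.not_mem_nil, or_false] at hq
      rcases hq with rfl | rfl | rfl | rfl
      exacts [hb, hnb, m1, m2])
  simp only [List.mem_cons, List.not_mem_nil, or_false, forall_eq_or_imp, forall_eq,
    Language.Formula.realize_not, hχ] at hx
  tauto

theorem exists_completion {α : Type u} (S : Set (L.Formula (α ⊕ ℕ) × (ℕ → M)))
    (hcons : ∀ l : List (L.Formula (α ⊕ ℕ) × (ℕ → M)), (∀ q ∈ l, q ∈ S) →
      ∃ x : α → M, ∀ q ∈ l, q.1.Realize (Sum.elim x q.2)) :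
    ∃ p : GType L M α, ∀ q ∈ S, p.mem q.1 q.2 := by
  obtain ⟨U, hU⟩ := exists_ultrafilter S (fun q x => q.1.Realize (Sum.elim x q.2)) hcons
  refine ⟨⟨fun φ b => {x | φ.Realize (Sum.elim x b)} ∈ U, ?_, ?_⟩, hU⟩
  · intro l hl
    have : {x : α → M | ∀ q ∈ l, q.1.Realize (Sum.elim x q.2)} ∈ U := by
      induction l with
      | nil => simp only [List.not_mem_nil, false_imp_iff, implies_true]; exact Filter.univ_mem
      | cons q l ih =>
        refine Filter.mem_of_superset (Filter.inter_mem
          (ih (fun q hq => hl q (List.mem_cons_of_mem _ hq))) (hl q List.mem_cons_self)) ?_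
        rintro e ⟨h3, h4⟩ q' hq'
        rcases List.mem_cons.1 hq' with rfl | hq'
        · exact h4
        · exact h3 q' hq'
    exact U.nonempty_of_mem this
  · intro φ b
    simp only [Language.Formula.realize_not]
    exact Ultrafilter.mem_or_compl_mem U {x | φ.Realize (Sum.elim x b)}

theorem divides_ulift {A : Set M} {α : Type u} (ψ : L.Formula (α ⊕ ℕ)) (c : ℕ → M)
    (h : Divides L M A ψ c) :
    Divides L M A (ψ.relabel (Sum.map id (ULift.up.{u}))) (fun i => c i.down) := by
  obtain ⟨k, bs, hbs, hk⟩ := h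
  refine ⟨k, fun i j => bs i j.down, fun i => (hbs i).comp ULift.down, ?_⟩
  rintro s hs ⟨x, hx⟩
  refine hk s hs ⟨x, fun i hi => ?_⟩
  have := hx i hi
  rw [Language.Formula.realize_relabel, Sum.elim_comp_map] at this
  exact this

end Helpers

/-- In a dependent theory, over a set `A` such that forking
equals dividing over `A`, every consistent partial type which is Lascar
invariant over `A` extends to a complete global type Lascar invariant
over `A`. -/
theorem lascar_invariant_global_extension
    (κ : Cardinal.{u}) (hM : IsMonster L M κ) (hnip : IsNIP L M)
    (A : Set M) (hA : Cardinal.mk A < κ) (hfd : ForkEqDiv L M A)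
    {α : Type u} (S : Set (L.Formula (α ⊕ ℕ) × (ℕ → M)))
    (hcons : ∀ l : List (L.Formula (α ⊕ ℕ) × (ℕ → M)), (∀ q ∈ l, q ∈ S) →
      ∃ x : α → M, ∀ q ∈ l, q.1.Realize (Sum.elim x q.2))
    (hinv : ∀ σ : M ≃[L] M, IsLascarStrong L M κ A σ →
      ∀ q ∈ S, ((q.1, fun i => σ (q.2 i)) : L.Formula (α ⊕ ℕ) × (ℕ → M)) ∈ S) :
    ∃ p : GType L M α, (∀ q ∈ S, p.mem q.1 q.2) ∧ GType.LascarInv L M κ A p := by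
  classical
  by_cases hsm : Nonempty M ∧ ∃ N : L.ElementarySubstructure M,
      Cardinal.mk (N : Set M) < κ ∧ A ⊆ (N : Set M)
  swap
  · obtain ⟨p, hp⟩ := exists_completion S hcons
    refine ⟨p, hp, ?_⟩
    rintro σ ⟨l, hl, rfl⟩ φ b
    have hMne : Nonempty M := ⟨b 0⟩
    cases l with
    | nil => simp
    | cons τ l =>
      obtain ⟨N, h1, h2, -⟩ := hl τ List.mem_cons_self
      exact absurd ⟨hMne, N, h1, h2⟩ hsm
  obtain ⟨hMne, N, hN, hAN⟩ := hsm
  obtain ⟨p, hp⟩ := exists_completion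
    (S ∪ {q | ∃ ψ : L.Formula (α ⊕ ℕ), q.1 = ψ.not ∧ Divides L M A ψ q.2}) (by
    intro l hl
    by_contra hcon
    obtain ⟨θ, c, -, hθ⟩ := exists_conj (Set.univ : Set M) Set.univ_nonempty
      (l.filter (fun q => q ∈ S)) (fun q _ => Set.subset_univ _)
    let l2 := l.filter (fun q => q ∉ S)
    have hl2 : ∀ i : Fin l2.length, ∃ ψ : L.Formula (α ⊕ ℕ),
        (l2.get i).1 = ψ.not ∧ Divides L M A ψ (l2.get i).2 := by
      intro i
      have hmem : l2.get i ∈ l2 := List.get_mem _ _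
      have := List.mem_filter.1 hmem
      rcases hl _ this.1 with h | h
      · exact absurd h (by simpa using this.2)
      · exact h
    choose ψ hψ1 hψ2 using hl2
    have hdiv := hfd α (ULift.{u} ℕ) (θ.relabel (Sum.map id ULift.up)) (fun i => c i.down)
      ⟨l2.length, fun _ => ULift.{u} ℕ, fun i => (ψ i).relabel (Sum.map id ULift.up),
        fun i j => (l2.get i).2 j.down, fun i => divides_ulift _ _ (hψ2 i), by
        intro x hx
        rw [Language.Formula.realize_relabel, Sum.elim_comp_map] at hx
        have h1 := hθ (Language.Equiv.refl L M) x
        simp only [Language.Equiv.refl_apply] at h1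
        replace h1 := h1.1 hx
        by_contra hno
        push Not at hno
        refine hcon ⟨x, fun q hq => ?_⟩
        by_cases hqS : q ∈ S
        · exact h1 q (List.mem_filter.2 ⟨hq, by simpa using hqS⟩)
        · have hq2 : q ∈ l2 := List.mem_filter.2 ⟨hq, by simpa using hqS⟩
          obtain ⟨i, rfl⟩ := List.get_of_mem hq2
          rw [hψ1 i, Language.Formula.realize_not]
          have := hno i
          rw [Language.Formula.realize_relabel, Sum.elim_comp_map] at this
          exact this⟩
    obtain ⟨n, τ, hτ, hinc⟩ := lascar_of_divides hM hA N hN hAN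
      (Cardinal.mk_le_aleph0.trans_lt hM.aleph0_lt) _ _ hdiv
    obtain ⟨x, hx⟩ := hcons ((List.finRange n).flatMap (fun j =>
        (l.filter (fun q => q ∈ S)).map (fun q => (q.1, fun i => τ j (q.2 i))))) (by
      intro q hq
      simp only [List.mem_flatMap, List.mem_map] at hq
      obtain ⟨j, -, q', hq', rfl⟩ := hq
      refine hinv (τ j) ⟨[τ j], ?_, by simp⟩ q' (by simpa using (List.mem_filter.1 hq').2)
      intro τ' hτ'
      rw [List.mem_singleton] at hτ'
      subst hτ'
      exact hτ j)
    refine hinc ⟨x, fun j => ?_⟩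
    rw [Language.Formula.realize_relabel, Sum.elim_comp_map]
    refine (hθ (τ j) x).2 fun q hq => ?_
    exact hx (q.1, fun i => τ j (q.2 i)) (List.mem_flatMap.2
      ⟨j, List.mem_finRange j, List.mem_map.2 ⟨q, hq, rfl⟩⟩))
  have hdiv : ∀ (ψ : L.Formula (α ⊕ ℕ)) (c : ℕ → M), Divides L M A ψ c → p.mem ψ.not c :=
    fun ψ c h => hp (ψ.not, c) (Or.inr ⟨ψ, rfl, h⟩)
  refine ⟨p, fun q hq => hp q (Or.inl hq), ?_⟩
  rintro σ ⟨l, hl, rfl⟩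
  have key : ∀ τ ∈ l, ∀ φ b, p.mem φ b ↔ p.mem φ (fun i => τ (b i)) := by
    intro τ hτ φ b
    obtain ⟨N', h1, h2, h3⟩ := hl τ hτ
    refine ⟨inv_of_nonforking hM hnip p hdiv N' h1 h2 τ h3 φ b, fun h => ?_⟩
    have h4 : FixesSet L M τ.symm (N' : Set M) := fun a ha => by
      conv_lhs => rw [← h3 a ha]
      simp
    have := inv_of_nonforking hM hnip p hdiv N' h1 h2 τ.symm h4 φ _ h
    simpa using this
  clear hl
  induction l with
  | nil => intro φ b; simp
  | cons τ l ih =>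
    intro φ b
    rw [ih (fun τ' hτ' => key τ' (List.mem_cons_of_mem _ hτ')) φ b,
      key τ List.mem_cons_self]
    simp

end ForkingNTP2
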